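/- Let λ : [0,∞) → (0,∞) be continuous with 1/λ not Lebesgue-integrable on (0,∞). Let p_λ(ξ) = ∫₀^ξ λ(ζ)⁻¹ dζ, a strictly increasing bijection of [0,∞) onto [0,∞), and set μ_λ(ξ,t) = p_λ⁻¹(p_λ(ξ)+t) − ξ for ξ, t ≥ 0. Define for t ≥ 0 the operator T_λ(t) on L²_λ(0,∞) by (T_λ(t)x)(ξ) = (λ(ξ+μ_λ(ξ,t))/λ(ξ))·x(ξ+μ_λ(ξ,t)). Then: (a) each T_λ(t) is a well-defined linear contraction of L²_λ(0,∞); (b) T_λ(0) = id and T_λ(t)∘T_λ(s) = T_λ(t+s) for all s, t ≥ 0; (c) t ↦ T_λ(t)x is continuous on [0,∞) for each x ∈ L²_λ(0,∞); and (d) for x ∈ L²_λ(0,∞), the limit lim_{t↓0}(T_λ(t)x − x)/t exists in L²_λ(0,∞) if and only if λ·x has a locally absolutely continuous representative on [0,∞) whose a.e. derivative (λ·x)′ belongs to L²_λ(0,∞), and in that case the limit equals (λ·x)′. (That is, (T_λ(t))_{t≥0} is a C₀-semigroup with generator A_λ x = (λ·x)′ on D(A_λ) = {x ∈ L²_λ(0,∞)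 : λ·x ∈ AC_loc[0,∞), (λ·x)′ ∈ L²_λ(0,∞)}, with no boundary condition at 0.) -/

import Mathlib

open MeasureTheory Filter Set Topology
open scoped ENNReal

theorem memLp_indicator_Ici {u : ℝ → ℂ} (hu : MemLp u 2 (volume.restrict (Ici 0))) :
    MemLp ((Ici (0 : ℝ)).indicator u) 2 volume :=
  (memLp_indicator_iff_restrict measurableSet_Ici).2 hu

theorem memLp_shift {u : ℝ → ℂ} (hu : MemLp u 2 (volume.restrict (Ici 0))) {t : ℝ} (ht : 0 ≤ t) :
    MemLp (fun s => u (s + t)) 2 (volume.restrict (Ici 0)) := by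
  have h := ((memLp_indicator_Ici hu).comp_measurePreserving
    (measurePreserving_add_right volume t)).restrict (Ici 0)
  refine (memLp_congr_ae ?_).1 h
  filter_upwards [ae_restrict_mem measurableSet_Ici] with s hs
  have : s + t ∈ Ici (0 : ℝ) := add_nonneg hs ht
  simp [indicator_of_mem this]

theorem ae_shift {P : ℝ → Prop} (h : ∀ᵐ s ∂volume.restrict (Ici (0 : ℝ)), P s) {t : ℝ}
    (ht : 0 ≤ t) : ∀ᵐ s ∂volume.restrict (Ici (0 : ℝ)), P (s + t) := by
  rw [ae_restrict_iff' measurableSet_Ici] at h ⊢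
  filter_upwards [(measurePreserving_add_right volume t).quasiMeasurePreserving.ae h] with s hs hs0
  exact hs (add_nonneg hs0 ht)

theorem integral_norm_sq_shift_le {u : ℝ → ℂ} (hu : MemLp u 2 (volume.restrict (Ici 0))) {t : ℝ}
    (ht : 0 ≤ t) : ∫ s in Ici (0 : ℝ), ‖u (s + t)‖ ^ 2 ≤ ∫ s in Ici (0 : ℝ), ‖u s‖ ^ 2 := by
  have h1 : ∫ s in Ici (0 : ℝ), ‖u (s + t)‖ ^ 2 = ∫ s in Ici t, ‖u s‖ ^ 2 := by
    have := (measurePreserving_add_right volume t).setIntegral_preimage_emb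
      (measurableEmbedding_addRight t) (fun s => ‖u s‖ ^ 2) (Ici t)
    simpa using this
  rw [h1]
  exact setIntegral_mono_set ((memLp_two_iff_integrable_sq_norm hu.1).1 hu)
    (ae_of_all _ fun _ => by positivity) (Ici_subset_Ici.2 ht).eventuallyLE

theorem eLpNorm_two_sq {μ : Measure ℝ} (f : ℝ → ℂ) :
    eLpNorm f 2 μ ^ 2 = ∫⁻ s, ‖f s‖ₑ ^ 2 ∂μ := by
  have := eLpNorm_nnreal_pow_eq_lintegral (f := f) (μ := μ) (p := 2) two_ne_zero
  simpa using this

theorem integral_norm_sq_eq_toReal {f : ℝ → ℂ} {μ : Measure ℝ} (hf : AEStronglyMeasurable f μ) :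
    ∫ s, ‖f s‖ ^ 2 ∂μ = (∫⁻ s, ‖f s‖ₑ ^ 2 ∂μ).toReal := by
  rw [integral_eq_lintegral_of_nonneg_ae (ae_of_all _ fun _ => by positivity)
    (by fun_prop)]
  congr 2 with s
  rw [ENNReal.ofReal_pow (norm_nonneg _), ofReal_norm]

theorem tendsto_integral_norm_sq_iff {ι : Type*} {l : Filter ι} {f : ι → ℝ → ℂ} {μ : Measure ℝ}
    (hf : ∀ᶠ i in l, MemLp (f i) 2 μ) :
    Tendsto (fun i => ∫ s, ‖f i s‖ ^ 2 ∂μ) l (𝓝 0) ↔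
      Tendsto (fun i => ∫⁻ s, ‖f i s‖ₑ ^ 2 ∂μ) l (𝓝 0) := by
  have e1 : (fun i => ∫ s, ‖f i s‖ ^ 2 ∂μ) =ᶠ[l] fun i => (∫⁻ s, ‖f i s‖ₑ ^ 2 ∂μ).toReal :=
    hf.mono fun i hi => integral_norm_sq_eq_toReal hi.1
  have e2 : (fun i => ∫⁻ s, ‖f i s‖ₑ ^ 2 ∂μ) =ᶠ[l]
      fun i => ENNReal.ofReal (∫ s, ‖f i s‖ ^ 2 ∂μ) := by
    filter_upwards [hf] with i hi
    rw [integral_norm_sq_eq_toReal hi.1, ENNReal.ofReal_toReal]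
    rw [← eLpNorm_two_sq]
    exact ENNReal.pow_ne_top hi.2.ne
  constructor <;> intro h
  · rw [tendsto_congr' e2]
    simpa using ENNReal.tendsto_ofReal h
  · rw [tendsto_congr' e1]
    exact (ENNReal.tendsto_toReal ENNReal.zero_ne_top).comp h

theorem tendsto_lintegral_shift_sub {u : ℝ → ℂ} (hu : MemLp u 2 (volume.restrict (Ici 0)))
    {t₀ : ℝ} (ht₀ : 0 ≤ t₀) :
    Tendsto (fun t => ∫⁻ s in Ici (0 : ℝ), ‖u (s + t) - u (s + t₀)‖ₑ ^ 2)
      (𝓝[Ici 0] t₀) (𝓝 0) := by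
  have hU := memLp_indicator_Ici hu
  have hcont : Continuous fun t : ℝ => DomAddAct.mk t +ᵥ hU.toLp := by
    have : Fact ((2 : ℝ≥0∞) ≠ ∞) := ⟨by simp⟩
    have : Continuous fun t : ℝ => DomAddAct.mk t := DomAddAct.mkHomeomorph.continuous
    fun_prop
  have h := (tendsto_iff_edist_tendsto_0.1 (hcont.tendsto t₀)).mono_left
    (nhdsWithin_le_nhds (s := Ici 0))
  have h2 := ENNReal.Tendsto.pow h (n := 2)
  rw [zero_pow two_ne_zero] at h2
  refine tendsto_of_tendsto_of_tendsto_of_le_of_le' tendsto_const_nhds h2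
    (Eventually.of_forall fun _ => zero_le) ?_
  filter_upwards [self_mem_nhdsWithin] with t ht
  rw [DomAddAct.mk_vadd_toLp, DomAddAct.mk_vadd_toLp, Lp.edist_toLp_toLp, eLpNorm_two_sq]
  refine le_trans ?_ (setLIntegral_le_lintegral (Ici 0) _)
  refine (setLIntegral_congr_fun measurableSet_Ici fun s hs => ?_).le
  have h1 : t + s ∈ Ici (0 : ℝ) := add_nonneg (mem_Ici.1 ht) (mem_Ici.1 hs)
  have h3 : t₀ + s ∈ Ici (0 : ℝ) := add_nonneg ht₀ (mem_Ici.1 hs)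
  simp [indicator_of_mem h1, indicator_of_mem h3, add_comm s]

theorem enorm_intervalIntegral_sq_le {f : ℝ → ℂ} {a b : ℝ} (hab : a ≤ b)
    (hf : AEStronglyMeasurable f (volume.restrict (Ioc a b))) :
    ‖∫ x in a..b, f x‖ₑ ^ 2 ≤ ENNReal.ofReal (b - a) * ∫⁻ x in Ioc a b, ‖f x‖ₑ ^ 2 := by
  rw [intervalIntegral.integral_of_le hab]
  have h1 := enorm_integral_le_lintegral_enorm (μ := volume.restrict (Ioc a b)) f
  have h2 := eLpNorm_le_eLpNorm_mul_rpow_measure_univ (p := 1) (q := 2) (by norm_num) hf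
  rw [eLpNorm_one_eq_lintegral_enorm] at h2
  have h3 := pow_le_pow_left' (h1.trans h2) 2
  rw [mul_pow, eLpNorm_two_sq, mul_comm] at h3
  refine h3.trans (le_of_eq ?_)
  congr 1
  rw [← ENNReal.rpow_natCast, ← ENNReal.rpow_mul]
  norm_num

theorem intervalIntegrable_of_memLp {v : ℝ → ℂ} (hv : MemLp v 2 (volume.restrict (Ici 0)))
    {a b : ℝ} (ha : 0 ≤ a) (hb : 0 ≤ b) : IntervalIntegrable v volume a b := by
  wlog hab : a ≤ b
  · exact (this hv hb ha (le_of_not_ge hab)).symm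
  rw [intervalIntegrable_iff_integrableOn_Ioc_of_le hab]
  have hs : Ioc a b ⊆ Ici 0 := fun x hx => ha.trans hx.1.le
  exact (hv.mono_measure (Measure.restrict_mono_set volume hs)).integrable (by norm_num)

theorem memLp_diffQuot_sub {u v : ℝ → ℂ} (hu : MemLp u 2 (volume.restrict (Ici 0)))
    (hv : MemLp v 2 (volume.restrict (Ici 0))) {t : ℝ} (ht : 0 ≤ t) :
    MemLp (fun s => (u (s + t) - u s) / (t : ℂ) - v s) 2 (volume.restrict (Ici 0)) := by
  simp_rw [div_eq_inv_mul]
  exact (((memLp_shift hu ht).sub hu).const_mul _).sub hv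

theorem lintegral_diffQuot_sub_le {w v : ℝ → ℂ} (hv : MemLp v 2 (volume.restrict (Ici 0)))
    (hw : ∀ a ∈ Ici (0 : ℝ), ∀ b ∈ Ici (0 : ℝ), w b - w a = ∫ r in a..b, v r)
    {t : ℝ} (ht : 0 < t) :
    ∫⁻ s in Ici (0 : ℝ), ‖(w (s + t) - w s) / (t : ℂ) - v s‖ₑ ^ 2 ≤
      (ENNReal.ofReal t)⁻¹ *
        ∫⁻ r in Ioc 0 t, ∫⁻ s in Ici (0 : ℝ), ‖v (s + r) - v s‖ₑ ^ 2 := by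
  obtain ⟨v', hv'm, hv'⟩ := hv.1
  have hv'2 : MemLp v' 2 (volume.restrict (Ici 0)) := (memLp_congr_ae hv').1 hv
  have hT : ENNReal.ofReal t ≠ 0 := by simpa using ht
  have key : ∀ᵐ s ∂volume.restrict (Ici (0 : ℝ)),
      ‖(w (s + t) - w s) / (t : ℂ) - v s‖ₑ ^ 2 ≤
        (ENNReal.ofReal t)⁻¹ * ∫⁻ r in Ioc 0 t, ‖v' (s + r) - v' s‖ₑ ^ 2 := by
    filter_upwards [hv', ae_restrict_mem measurableSet_Ici] with s hs hs0
    have hst : 0 ≤ s + t := add_nonneg hs0 ht.le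
    have hI : IntervalIntegrable (fun r => v' (s + r)) volume 0 t := by
      have := (intervalIntegrable_of_memLp hv'2 hs0 hst).comp_add_left s
      simpa using this
    have e1 : w (s + t) - w s = ∫ r in (0 : ℝ)..t, v' (s + r) := by
      rw [hw s hs0 _ hst, intervalIntegral.integral_comp_add_left, add_zero]
      refine intervalIntegral.integral_congr_ae ?_
      rw [uIoc_of_le (by linarith)]
      have := (ae_restrict_iff' measurableSet_Ici).1 hv'
      filter_upwards [this] with r hr hr1
      exact hr (le_trans hs0 hr1.1.le)
    have e2 : (w (s + t) - w s) / (t : ℂ) - v s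
        = (t : ℂ)⁻¹ * ∫ r in (0 : ℝ)..t, (v' (s + r) - v' s) := by
      have htc : (t : ℂ) ≠ 0 := by exact_mod_cast ht.ne'
      rw [intervalIntegral.integral_sub hI (by simp), e1, hs]
      simp only [intervalIntegral.integral_const, sub_zero, Complex.real_smul]
      field_simp
    have hn : ‖(t : ℂ)⁻¹‖ₑ = (ENNReal.ofReal t)⁻¹ := by
      rw [enorm_inv (by exact_mod_cast ht.ne'), ← ofReal_norm, Complex.norm_real,
        Real.norm_of_nonneg ht.le]
    rw [e2, enorm_mul, mul_pow, hn]
    have h3 := enorm_intervalIntegral_sq_le (f := fun r => v' (s + r) - v' s) ht.le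
      (by have := hv'm.measurable
          exact (by fun_prop : Measurable fun r => v' (s + r) - v' s).aestronglyMeasurable)
    rw [sub_zero] at h3
    calc _ ≤ (ENNReal.ofReal t)⁻¹ ^ 2 * (ENNReal.ofReal t *
            ∫⁻ r in Ioc 0 t, ‖v' (s + r) - v' s‖ₑ ^ 2) := by gcongr
      _ = _ := by
        rw [← mul_assoc, sq, mul_assoc (ENNReal.ofReal t)⁻¹,
          ENNReal.inv_mul_cancel hT ENNReal.ofReal_ne_top, mul_one]
  refine (lintegral_mono_ae key).trans ?_
  rw [lintegral_const_mul' _ _ (ENNReal.inv_ne_top.2 hT), lintegral_lintegral_swap]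
  · refine mul_le_mul_right ?_ _
    refine (setLIntegral_congr_fun measurableSet_Ioc fun r hr => ?_).le
    refine lintegral_congr_ae ?_
    filter_upwards [hv', ae_shift hv' hr.1.le] with s h1 h2
    simp only [h1, h2]
  · have := hv'm.measurable
    fun_prop

theorem tendsto_diffQuot_of_integral {u v w : ℝ → ℂ}
    (hv : MemLp v 2 (volume.restrict (Ici 0)))
    (hwu : w =ᵐ[volume.restrict (Ici 0)] u)
    (hw : ∀ a ∈ Ici (0 : ℝ), ∀ b ∈ Ici (0 : ℝ), w b - w a = ∫ r in a..b, v r) :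
    Tendsto (fun t : ℝ => ∫⁻ s in Ici (0 : ℝ), ‖(u (s + t) - u s) / (t : ℂ) - v s‖ₑ ^ 2)
      (𝓝[>] 0) (𝓝 0) := by
  rw [ENNReal.tendsto_nhds_zero]
  intro ε hε
  have h := ENNReal.tendsto_nhds_zero.1 (tendsto_lintegral_shift_sub hv le_rfl) ε hε
  simp only [add_zero] at h
  rw [eventually_nhdsWithin_iff, Metric.eventually_nhds_iff] at h
  obtain ⟨δ, hδ, h⟩ := h
  filter_upwards [Ioo_mem_nhdsGT hδ] with t ht
  have hT : ENNReal.ofReal t ≠ 0 := by simpa using ht.1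
  calc ∫⁻ s in Ici (0 : ℝ), ‖(u (s + t) - u s) / (t : ℂ) - v s‖ₑ ^ 2
      = ∫⁻ s in Ici (0 : ℝ), ‖(w (s + t) - w s) / (t : ℂ) - v s‖ₑ ^ 2 := by
        refine lintegral_congr_ae ?_
        filter_upwards [hwu, ae_shift hwu ht.1.le] with s h1 h2
        rw [h1, h2]
    _ ≤ _ := lintegral_diffQuot_sub_le hv hw ht.1
    _ ≤ (ENNReal.ofReal t)⁻¹ * ∫⁻ r in Ioc 0 t, ε := by
        refine mul_le_mul_right ?_ _
        refine setLIntegral_mono' measurableSet_Ioc fun r hr => h (y := r) ?_ hr.1.le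
        rw [Real.dist_eq, sub_zero, abs_of_pos hr.1]
        exact hr.2.trans_lt ht.2
    _ = ε := by
        rw [setLIntegral_const, Real.volume_Ioc, sub_zero, mul_comm, mul_assoc,
          ENNReal.mul_inv_cancel hT ENNReal.ofReal_ne_top, mul_one]

theorem exists_integral_of_tendsto_diffQuot {u v : ℝ → ℂ}
    (hu : MemLp u 2 (volume.restrict (Ici 0))) (hv : MemLp v 2 (volume.restrict (Ici 0)))
    (h : Tendsto (fun t : ℝ => ∫⁻ s in Ici (0 : ℝ), ‖(u (s + t) - u s) / (t : ℂ) - v s‖ₑ ^ 2)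
      (𝓝[>] 0) (𝓝 0)) :
    ∃ w : ℝ → ℂ, w =ᵐ[volume.restrict (Ici 0)] u ∧
      ∀ a ∈ Ici (0 : ℝ), ∀ b ∈ Ici (0 : ℝ), w b - w a = ∫ r in a..b, v r := by
  have hui := fun {a b : ℝ} => intervalIntegrable_of_memLp hu (a := a) (b := b)
  have hvi := fun {a b : ℝ} => intervalIntegrable_of_memLp hv (a := a) (b := b)
  have hder : ∀ᵐ s ∂volume.restrict (Ici (0 : ℝ)),
      HasDerivWithinAt (fun x => ∫ r in (0 : ℝ)..x, u r) (u s) (Ioi s) s := by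
    have hloc : LocallyIntegrable ((Ici (0 : ℝ)).indicator u) volume :=
      (memLp_indicator_Ici hu).locallyIntegrable (by norm_num)
    rw [ae_restrict_iff' measurableSet_Ici]
    filter_upwards [LocallyIntegrable.ae_hasDerivAt_integral hloc] with s hs hs0
    have h1 := (hs 0).hasDerivWithinAt (s := Ioi s)
    rw [indicator_of_mem hs0] at h1
    have heq : ∀ x, 0 ≤ x → ∫ r in (0 : ℝ)..x, u r =
        ∫ r in (0 : ℝ)..x, (Ici (0 : ℝ)).indicator u r := fun x hx => by
      refine intervalIntegral.integral_congr fun r hr => ?_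
      rw [uIcc_of_le hx] at hr
      exact (indicator_of_mem (show r ∈ Ici (0 : ℝ) from hr.1) u).symm
    exact h1.congr (fun x hx => heq x (le_trans hs0 (le_of_lt hx))) (heq s hs0)
  -- the increments of `u` between points of differentiability are integrals of `v`
  have hinc : ∀ a b : ℝ, 0 ≤ a → a ≤ b →
      HasDerivWithinAt (fun x => ∫ r in (0 : ℝ)..x, u r) (u a) (Ioi a) a →
      HasDerivWithinAt (fun x => ∫ r in (0 : ℝ)..x, u r) (u b) (Ioi b) b →
      u b - u a = ∫ r in a..b, v r := by
    intro a b ha hab hda hdb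
    have hb := ha.trans hab
    have slope : ∀ {c : ℝ}, 0 ≤ c →
        HasDerivWithinAt (fun x => ∫ r in (0 : ℝ)..x, u r) (u c) (Ioi c) c →
        Tendsto (fun t : ℝ => (t : ℂ)⁻¹ * ∫ r in c..(c + t), u r) (𝓝[>] 0) (𝓝 (u c)) := by
      intro c hc hd
      have h1 := (hasDerivWithinAt_iff_tendsto_slope' (by simp)).1 hd
      have h2 : Tendsto (fun t : ℝ => c + t) (𝓝[>] 0) (𝓝[>] c) := by
        refine tendsto_nhdsWithin_of_tendsto_nhds_of_eventually_within _ ?_ ?_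
        · have := (continuous_const_add c).tendsto 0
          rw [add_zero] at this
          exact this.mono_left nhdsWithin_le_nhds
        · filter_upwards [self_mem_nhdsWithin] with t ht
          exact lt_add_of_pos_right c ht
      refine (h1.comp h2).congr' ?_
      filter_upwards [self_mem_nhdsWithin] with t ht
      have hct : 0 ≤ c + t := add_nonneg hc (le_of_lt ht)
      rw [Function.comp, slope_def_module, intervalIntegral.integral_interval_sub_left
        (hui le_rfl hct) (hui le_rfl hc)]
      simp [Complex.real_smul]
    have lim1 := (slope hb hdb).sub (slope ha hda)
    have lim2 : Tendsto (fun t : ℝ => ∫ s in a..b, (u (s + t) - u s) / (t : ℂ)) (𝓝[>] 0)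
        (𝓝 (∫ r in a..b, v r)) := by
      rw [tendsto_iff_edist_tendsto_0]
      have hm := ENNReal.Tendsto.const_mul (a := ENNReal.ofReal (b - a)) h
        (Or.inr ENNReal.ofReal_ne_top)
      rw [mul_zero] at hm
      have hsq : Tendsto (fun t : ℝ => edist (∫ s in a..b, (u (s + t) - u s) / (t : ℂ))
          (∫ r in a..b, v r) ^ 2) (𝓝[>] 0) (𝓝 0) := by
        refine tendsto_of_tendsto_of_tendsto_of_le_of_le' tendsto_const_nhds hm
          (Eventually.of_forall fun _ => zero_le) ?_
        filter_upwards [self_mem_nhdsWithin] with t ht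
        have ht0 : 0 ≤ t := le_of_lt ht
        have hq := memLp_diffQuot_sub hu hv ht0
        have hsub : Ioc a b ⊆ Ici 0 := fun x hx => ha.trans hx.1.le
        have hdi : IntervalIntegrable (fun s => (u (s + t) - u s) / (t : ℂ)) volume a b :=
          ((intervalIntegrable_of_memLp (memLp_shift hu ht0) ha hb).sub (hui ha hb)).div_const _
        rw [edist_eq_enorm_sub, ← intervalIntegral.integral_sub hdi (hvi ha hb)]
        refine (enorm_intervalIntegral_sq_le hab
          (hq.1.mono_measure (Measure.restrict_mono_set volume hsub))).trans ?_
        gcongr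
      have := (ENNReal.continuous_rpow_const (y := 1 / 2)).tendsto 0 |>.comp hsq
      simp only [Function.comp_def, ← ENNReal.rpow_natCast, ← ENNReal.rpow_mul] at this
      simpa using this
    refine tendsto_nhds_unique (lim1.congr' ?_) lim2
    filter_upwards [self_mem_nhdsWithin] with t ht
    have ht0 : 0 ≤ t := le_of_lt ht
    have hat : 0 ≤ a + t := add_nonneg ha ht0
    have hbt : 0 ≤ b + t := add_nonneg hb ht0
    rw [intervalIntegral.integral_div, intervalIntegral.integral_sub
      (intervalIntegrable_of_memLp (memLp_shift hu ht0) ha hb) (hui ha hb),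
      intervalIntegral.integral_comp_add_right, ← mul_sub, div_eq_inv_mul]
    congr 1
    have e1 := intervalIntegral.integral_add_adjacent_intervals (hui ha hb) (hui hb hbt)
    have e2 := intervalIntegral.integral_add_adjacent_intervals (hui ha hat) (hui hat hbt)
    linear_combination e1 - e2
  obtain ⟨a₀, hda, ha₀⟩ : ∃ a₀ : ℝ,
      HasDerivWithinAt (fun x => ∫ r in (0 : ℝ)..x, u r) (u a₀) (Ioi a₀) a₀ ∧ 0 ≤ a₀ := by
    have : (ae (volume.restrict (Ici (0 : ℝ)))).NeBot := by
      rw [ae_neBot]; simp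
    exact (hder.and (ae_restrict_mem measurableSet_Ici)).exists
  refine ⟨fun s => u a₀ + ∫ r in a₀..s, v r, ?_, fun a ha b hb => ?_⟩
  · filter_upwards [hder, ae_restrict_mem measurableSet_Ici] with s hs hs0
    rcases le_total a₀ s with hle | hle
    · rw [← hinc a₀ s ha₀ hle hda hs]; ring
    · rw [intervalIntegral.integral_symm, ← hinc s a₀ hs0 hle hs hda]; ring
  · rw [add_sub_add_left_eq_sub, intervalIntegral.integral_interval_sub_left
      (hvi ha₀ hb) (hvi ha₀ ha)]

/-- `p` is an increasing change of variables of `[0,∞)` with derivative `1/λ` and inverse `q`. -/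
structure IsReparam (lam p q : ℝ → ℝ) : Prop where
  pos : ∀ ξ, 0 ≤ ξ → 0 < lam ξ
  continuousOn : ContinuousOn lam (Ici 0)
  nonneg : ∀ ξ, 0 ≤ ξ → 0 ≤ p ξ
  nonneg_inv : ∀ s, 0 ≤ s → 0 ≤ q s
  left_inv : ∀ ξ, 0 ≤ ξ → q (p ξ) = ξ
  right_inv : ∀ s, 0 ≤ s → p (q s) = s
  strictMonoOn : StrictMonoOn p (Ici 0)
  hasDerivWithinAt : ∀ ξ, 0 ≤ ξ → HasDerivWithinAt p (lam ξ)⁻¹ (Ici 0) ξ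
  hasDerivWithinAt_inv : ∀ s, 0 ≤ s → HasDerivWithinAt q (lam (q s)) (Ici 0) s

theorem hasDerivWithinAt_integral_of_continuousOn_Ici {f : ℝ → ℝ} (hf : ContinuousOn f (Ici 0))
    {ξ : ℝ} (hξ : 0 ≤ ξ) :
    HasDerivWithinAt (fun x => ∫ ζ in (0 : ℝ)..x, f ζ) (f ξ) (Ici 0) ξ := by
  have hF : Continuous fun ζ => f (max 0 ζ) :=
    hf.comp_continuous (by fun_prop) fun ζ => le_max_left 0 ζ
  have h := ((hF.integral_hasStrictDerivAt 0 ξ).hasDerivAt).hasDerivWithinAt (s := Ici 0)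
  rw [max_eq_right hξ] at h
  have heq : ∀ x ∈ Ici (0 : ℝ), ∫ ζ in (0 : ℝ)..x, f ζ = ∫ ζ in (0 : ℝ)..x, f (max 0 ζ) :=
    fun x hx => by
      refine intervalIntegral.integral_congr fun r hr => ?_
      rw [uIcc_of_le hx] at hr
      simp only [max_eq_right hr.1]
  exact h.congr heq (heq ξ hξ)

theorem isReparam_of_integral {lam p q : ℝ → ℝ} (hc : ContinuousOn lam (Ici 0))
    (hpos : ∀ ξ ∈ Ici (0 : ℝ), 0 < lam ξ) (hp : ∀ ξ, p ξ = ∫ ζ in (0 : ℝ)..ξ, (lam ζ)⁻¹)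
    (hq : ∀ s ∈ Ici (0 : ℝ), q s ∈ Ici (0 : ℝ)) (hright : ∀ s ∈ Ici (0 : ℝ), p (q s) = s)
    (hleft : ∀ ξ ∈ Ici (0 : ℝ), q (p ξ) = ξ) : IsReparam lam p q := by
  have hd : ∀ ξ, 0 ≤ ξ → HasDerivWithinAt p (lam ξ)⁻¹ (Ici 0) ξ := fun ξ hξ => by
    rw [funext hp]
    exact hasDerivWithinAt_integral_of_continuousOn_Ici
      (hc.inv₀ fun x hx => (hpos x hx).ne') hξ
  have hm : StrictMonoOn p (Ici 0) := by
    refine strictMonoOn_of_deriv_pos (convex_Ici 0)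
      (fun ξ hξ => (hd ξ hξ).continuousWithinAt) fun ξ hξ => ?_
    rw [interior_Ici] at hξ
    rw [((hd ξ (le_of_lt hξ)).hasDerivAt (Ici_mem_nhds hξ)).deriv]
    exact inv_pos.2 (hpos ξ (mem_Ici.2 (le_of_lt hξ)))
  have hp0 : p 0 = 0 := by simp [hp]
  have hnn : ∀ ξ, 0 ≤ ξ → 0 ≤ p ξ := fun ξ hξ => by
    rw [← hp0]; exact hm.monotoneOn self_mem_Ici hξ hξ
  let e : Ici (0 : ℝ) ≃o Ici (0 : ℝ) :=
    { toFun := fun ξ => ⟨p ξ, hnn ξ ξ.2⟩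
      invFun := fun s => ⟨q s, hq s s.2⟩
      left_inv := fun ξ => Subtype.ext (hleft ξ ξ.2)
      right_inv := fun s => Subtype.ext (hright s s.2)
      map_rel_iff' := fun {a b} => hm.le_iff_le a.2 b.2 }
  have hqc : ContinuousOn q (Ici 0) := by
    rw [continuousOn_iff_continuous_domRestrict]
    exact continuous_subtype_val.comp e.symm.continuous
  refine ⟨hpos, hc, hnn, hq, hleft, hright, hm, hd, fun s hs => ?_⟩
  have hq0 := hpos (q s) (hq s hs)
  have h := HasFDerivWithinAt.of_comp_of_leftInverse
    (f'symm := ContinuousLinearMap.toSpanSingleton ℝ (lam (q s))) (s := Ici 0) (t := Ici 0)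
    ((hqc s hs).tendsto_nhdsWithin hq) (hd (q s) (hq s hs)).hasFDerivWithinAt
    (hasFDerivWithinAt_id s (Ici 0))
    (by filter_upwards [self_mem_nhdsWithin] with x hx using hright x hx)
  simpa using (h (fun x => by simp [hq0.ne']) hs).hasDerivWithinAt

/-- The unitary map `f ↦ (λ f) ∘ q` from `L²_λ(0,∞)` to `L²(0,∞)`. -/
noncomputable def reparamMap (lam q : ℝ → ℝ) (f : ℝ → ℂ) (s : ℝ) : ℂ := (lam (q s) : ℂ) * f (q s)

theorem map_restrict_Ici_absolutelyContinuous {f g : ℝ → ℝ} (hf : DifferentiableOn ℝ f (Ici 0))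
    (hg : ContinuousOn g (Ici 0)) (hg0 : ∀ s, 0 ≤ s → 0 ≤ g s)
    (hfg : ∀ s, 0 ≤ s → f (g s) = s) :
    (volume.restrict (Ici 0)).map g ≪ volume.restrict (Ici (0 : ℝ)) := by
  refine Measure.AbsolutelyContinuous.mk fun N hN h0 => ?_
  rw [Measure.map_apply_of_aemeasurable (hg.aemeasurable measurableSet_Ici) hN,
    Measure.restrict_apply' measurableSet_Ici]
  rw [Measure.restrict_apply hN] at h0
  refine measure_mono_null ?_ (addHaar_image_eq_zero_of_differentiableOn_of_addHaar_eq_zero volume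
    (hf.mono inter_subset_right) h0)
  rintro s ⟨hs, hs0⟩
  exact ⟨g s, ⟨hs, hg0 s hs0⟩, hfg s hs0⟩

namespace IsReparam

variable {lam p q : ℝ → ℝ}

theorem image_Ici (H : IsReparam lam p q) : p '' Ici 0 = Ici 0 :=
  Subset.antisymm (image_subset_iff.2 H.nonneg) fun s hs =>
    ⟨q s, H.nonneg_inv s hs, H.right_inv s hs⟩

theorem continuousOn_fun (H : IsReparam lam p q) : ContinuousOn p (Ici 0) :=
  fun ξ hξ => (H.hasDerivWithinAt ξ hξ).continuousWithinAt

theorem continuousOn_inv (H : IsReparam lam p q) : ContinuousOn q (Ici 0) :=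
  fun s hs => (H.hasDerivWithinAt_inv s hs).continuousWithinAt

theorem map_ac (H : IsReparam lam p q) :
    (volume.restrict (Ici 0)).map p ≪ volume.restrict (Ici (0 : ℝ)) :=
  map_restrict_Ici_absolutelyContinuous
    (fun s hs => (H.hasDerivWithinAt_inv s hs).differentiableWithinAt) H.continuousOn_fun
    H.nonneg H.left_inv

theorem map_inv_ac (H : IsReparam lam p q) :
    (volume.restrict (Ici 0)).map q ≪ volume.restrict (Ici (0 : ℝ)) :=
  map_restrict_Ici_absolutelyContinuous
    (fun s hs => (H.hasDerivWithinAt s hs).differentiableWithinAt) H.continuousOn_inv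
    H.nonneg_inv H.right_inv

theorem ae_comp (H : IsReparam lam p q) {P : ℝ → Prop}
    (h : ∀ᵐ s ∂volume.restrict (Ici (0 : ℝ)), P s) :
    ∀ᵐ ξ ∂volume.restrict (Ici (0 : ℝ)), P (p ξ) :=
  ae_of_ae_map (H.continuousOn_fun.aemeasurable measurableSet_Ici) (H.map_ac.ae_le h)

theorem ae_comp_inv (H : IsReparam lam p q) {P : ℝ → Prop}
    (h : ∀ᵐ ξ ∂volume.restrict (Ici (0 : ℝ)), P ξ) :
    ∀ᵐ s ∂volume.restrict (Ici (0 : ℝ)), P (q s) :=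
  ae_of_ae_map (H.continuousOn_inv.aemeasurable measurableSet_Ici) (H.map_inv_ac.ae_le h)

theorem aestronglyMeasurable_lam (H : IsReparam lam p q) :
    AEStronglyMeasurable (fun ξ => (lam ξ : ℂ)) (volume.restrict (Ici 0)) :=
  (Complex.continuous_ofReal.comp_continuousOn H.continuousOn).aestronglyMeasurable
    measurableSet_Ici

theorem aestronglyMeasurable_reparamMap (H : IsReparam lam p q) {f : ℝ → ℂ}
    (hf : AEStronglyMeasurable f (volume.restrict (Ici 0))) :
    AEStronglyMeasurable (reparamMap lam q f) (volume.restrict (Ici 0)) :=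
  ((H.aestronglyMeasurable_lam.mul hf).mono_ac H.map_inv_ac).comp_aemeasurable
    (H.continuousOn_inv.aemeasurable measurableSet_Ici)

theorem reparamMap_apply (H : IsReparam lam p q) (f : ℝ → ℂ) {ξ : ℝ} (hξ : 0 ≤ ξ) :
    reparamMap lam q f (p ξ) = lam ξ * f ξ := by
  rw [reparamMap, H.left_inv ξ hξ]

theorem aestronglyMeasurable_of_reparamMap (H : IsReparam lam p q) {f : ℝ → ℂ}
    (hf : AEStronglyMeasurable (reparamMap lam q f) (volume.restrict (Ici 0))) :
    AEStronglyMeasurable f (volume.restrict (Ici 0)) := by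
  have h := (hf.mono_ac H.map_ac).comp_aemeasurable
    (H.continuousOn_fun.aemeasurable measurableSet_Ici)
  refine (H.aestronglyMeasurable_lam.aemeasurable.inv.aestronglyMeasurable.mul h).congr ?_
  filter_upwards [ae_restrict_mem measurableSet_Ici] with ξ hξ
  have : (lam ξ : ℂ) ≠ 0 := by exact_mod_cast (H.pos ξ hξ).ne'
  simp [H.reparamMap_apply f hξ, this]

theorem norm_sq_reparamMap (H : IsReparam lam p q) (f : ℝ → ℂ) {ξ : ℝ} (hξ : 0 ≤ ξ) :
    |(lam ξ)⁻¹| • ‖reparamMap lam q f (p ξ)‖ ^ 2 = lam ξ * ‖f ξ‖ ^ 2 := by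
  have h := H.pos ξ hξ
  rw [H.reparamMap_apply f hξ, norm_mul, Complex.norm_real, Real.norm_of_nonneg h.le,
    abs_of_pos (inv_pos.2 h), smul_eq_mul]
  field_simp

theorem integrableOn_norm_sq_reparamMap (H : IsReparam lam p q) (f : ℝ → ℂ) :
    IntegrableOn (fun s => ‖reparamMap lam q f s‖ ^ 2) (Ici 0) ↔
      IntegrableOn (fun ξ => lam ξ * ‖f ξ‖ ^ 2) (Ici 0) := by
  have h := integrableOn_image_iff_integrableOn_abs_deriv_smul measurableSet_Ici
    H.hasDerivWithinAt H.strictMonoOn.injOn (fun s => ‖reparamMap lam q f s‖ ^ 2)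
  rw [H.image_Ici] at h
  rw [h]
  exact integrableOn_congr_fun (fun ξ hξ => H.norm_sq_reparamMap f hξ) measurableSet_Ici

theorem integral_norm_sq_reparamMap (H : IsReparam lam p q) (f : ℝ → ℂ) :
    ∫ ξ in Ici (0 : ℝ), lam ξ * ‖f ξ‖ ^ 2 = ∫ s in Ici (0 : ℝ), ‖reparamMap lam q f s‖ ^ 2 := by
  have h := integral_image_eq_integral_abs_deriv_smul measurableSet_Ici
    H.hasDerivWithinAt H.strictMonoOn.injOn (fun s => ‖reparamMap lam q f s‖ ^ 2)
  rw [H.image_Ici] at h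
  rw [h]
  exact (setIntegral_congr_fun measurableSet_Ici fun ξ hξ => H.norm_sq_reparamMap f hξ).symm

theorem memLp_reparamMap (H : IsReparam lam p q) {f : ℝ → ℂ}
    (hf : AEStronglyMeasurable f (volume.restrict (Ici 0)))
    (hf2 : IntegrableOn (fun ξ => lam ξ * ‖f ξ‖ ^ 2) (Ici 0)) :
    MemLp (reparamMap lam q f) 2 (volume.restrict (Ici 0)) :=
  (memLp_two_iff_integrable_sq_norm (H.aestronglyMeasurable_reparamMap hf)).2
    ((H.integrableOn_norm_sq_reparamMap f).2 hf2)

theorem intervalIntegral_reparamMap (H : IsReparam lam p q) (g : ℝ → ℂ) {a b : ℝ} (ha : 0 ≤ a)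
    (hb : 0 ≤ b) : ∫ s in (p a)..(p b), reparamMap lam q g s = ∫ ξ in a..b, g ξ := by
  wlog hab : a ≤ b
  · rw [intervalIntegral.integral_symm, this H g hb ha (le_of_not_ge hab),
      ← intervalIntegral.integral_symm]
  have hsub : Icc a b ⊆ Ici 0 := fun x hx => ha.trans hx.1
  have him : p '' Icc a b = Icc (p a) (p b) := by
    refine Subset.antisymm (image_subset_iff.2 fun x hx => ?_) ?_
    · exact ⟨H.strictMonoOn.monotoneOn ha (hsub hx) hx.1,
        H.strictMonoOn.monotoneOn (hsub hx) hb hx.2⟩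
    · exact intermediate_value_Icc hab (H.continuousOn_fun.mono hsub)
  have h := integral_image_eq_integral_abs_deriv_smul measurableSet_Icc
    (fun x hx => (H.hasDerivWithinAt x (hsub hx)).mono hsub) (H.strictMonoOn.injOn.mono hsub)
    (reparamMap lam q g)
  rw [intervalIntegral.integral_of_le (H.strictMonoOn.monotoneOn ha hb hab),
    intervalIntegral.integral_of_le hab, ← integral_Icc_eq_integral_Ioc,
    ← integral_Icc_eq_integral_Ioc, ← him, h]
  refine setIntegral_congr_fun measurableSet_Icc fun ξ hξ => ?_
  have h0 := H.pos ξ (hsub hξ)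
  have h1 : (lam ξ : ℂ) ≠ 0 := by exact_mod_cast h0.ne'
  simp only [H.reparamMap_apply g (hsub hξ), abs_of_pos (inv_pos.2 h0), Complex.real_smul,
    Complex.ofReal_inv]
  field_simp

theorem exists_integral_reparamMap_iff (H : IsReparam lam p q) (x g : ℝ → ℂ) :
    (∃ w : ℝ → ℂ, w =ᵐ[volume.restrict (Ici 0)] reparamMap lam q x ∧
      ∀ a ∈ Ici (0 : ℝ), ∀ b ∈ Ici (0 : ℝ), w b - w a = ∫ r in a..b, reparamMap lam q g r) ↔
    ∃ y : ℝ → ℂ, (∀ᵐ ξ ∂volume.restrict (Ici 0), y ξ = (lam ξ : ℂ) * x ξ) ∧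
      ∀ a ∈ Ici (0 : ℝ), ∀ b ∈ Ici (0 : ℝ), y b - y a = ∫ ζ in a..b, g ζ := by
  constructor
  · rintro ⟨w, hw, hwi⟩
    refine ⟨fun ξ => w (p ξ), ?_, fun a ha b hb => ?_⟩
    · filter_upwards [H.ae_comp hw, ae_restrict_mem measurableSet_Ici] with ξ h1 h2
      rw [h1, H.reparamMap_apply x h2]
    · rw [hwi _ (H.nonneg a ha) _ (H.nonneg b hb), H.intervalIntegral_reparamMap g ha hb]
  · rintro ⟨y, hy, hyi⟩
    refine ⟨fun s => y (q s), H.ae_comp_inv hy, fun a ha b hb => ?_⟩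
    rw [hyi _ (H.nonneg_inv a ha) _ (H.nonneg_inv b hb),
      ← H.intervalIntegral_reparamMap g (H.nonneg_inv a ha) (H.nonneg_inv b hb),
      H.right_inv a ha, H.right_inv b hb]

end IsReparam

/-- The weighted left-shift semigroup on `L²_λ(0,∞)` is a strongly continuous
contraction semigroup whose generator is `A_λ x = (λ·x)'` on
`D(A_λ) = {x ∈ L²_λ(0,∞) : λ·x ∈ AC_loc[0,∞), (λ·x)' ∈ L²_λ(0,∞)}`
(no boundary condition at `0`). -/
theorem stmt_15 (lam : ℝ → ℝ)
    (hc : ContinuousOn lam (Set.Ici 0))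
    (hpos : ∀ ξ ∈ Set.Ici (0:ℝ), 0 < lam ξ)
    (hni : ¬ IntegrableOn (fun ζ => (lam ζ)⁻¹) (Set.Ioi 0))
    -- `p_λ(ξ) = ∫₀^ξ λ(ζ)⁻¹ dζ`
    (p : ℝ → ℝ) (hp : ∀ ξ, p ξ = ∫ ζ in (0:ℝ)..ξ, (lam ζ)⁻¹)
    -- `p_λ` is a strictly increasing bijection of `[0,∞)` onto `[0,∞)`
    -- with inverse `pinv`
    (pinv : ℝ → ℝ)
    (hpinv_mem : ∀ s ∈ Set.Ici (0:ℝ), pinv s ∈ Set.Ici (0:ℝ))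
    (hpinv_right : ∀ s ∈ Set.Ici (0:ℝ), p (pinv s) = s)
    (hpinv_left : ∀ ξ ∈ Set.Ici (0:ℝ), pinv (p ξ) = ξ)
    -- `μ_λ(ξ,t) = p_λ⁻¹(p_λ(ξ)+t) − ξ`
    (mu : ℝ → ℝ → ℝ) (hmu : ∀ ξ t, mu ξ t = pinv (p ξ + t) - ξ)
    -- `(T_λ(t)x)(ξ) = (λ(ξ+μ_λ(ξ,t))/λ(ξ)) · x(ξ+μ_λ(ξ,t))`
    (T : ℝ → (ℝ → ℂ) → ℝ → ℂ)
    (hT : ∀ t x ξ, T t x ξ = ((lam (ξ + mu ξ t) / lam ξ : ℝ) : ℂ) * x (ξ + mu ξ t)) :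
    -- (a) each `T_λ(t)`, `t ≥ 0`, is a well-defined linear contraction of `L²_λ(0,∞)`
    (∀ x y : ℝ → ℂ, ∀ c : ℂ, ∀ t ξ : ℝ,
      T t (fun ζ => x ζ + c • y ζ) ξ = T t x ξ + c • T t y ξ) ∧
    (∀ t : ℝ, 0 ≤ t → ∀ x : ℝ → ℂ,
      AEStronglyMeasurable x (volume.restrict (Set.Ici 0)) →
      IntegrableOn (fun ξ => lam ξ * ‖x ξ‖ ^ 2) (Set.Ici 0) →
      AEStronglyMeasurable (T t x) (volume.restrict (Set.Ici 0)) ∧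
      IntegrableOn (fun ξ => lam ξ * ‖T t x ξ‖ ^ 2) (Set.Ici 0) ∧
      (∫ ξ in Set.Ici (0:ℝ), lam ξ * ‖T t x ξ‖ ^ 2) ≤
        ∫ ξ in Set.Ici (0:ℝ), lam ξ * ‖x ξ‖ ^ 2) ∧
    -- (b) semigroup property
    (∀ x : ℝ → ℂ, ∀ ξ ∈ Set.Ici (0:ℝ), T 0 x ξ = x ξ) ∧
    (∀ s t : ℝ, 0 ≤ s → 0 ≤ t → ∀ x : ℝ → ℂ, ∀ ξ ∈ Set.Ici (0:ℝ),
      T t (T s x) ξ = T (t + s) x ξ) ∧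
    -- (c) strong continuity
    (∀ x : ℝ → ℂ,
      AEStronglyMeasurable x (volume.restrict (Set.Ici 0)) →
      IntegrableOn (fun ξ => lam ξ * ‖x ξ‖ ^ 2) (Set.Ici 0) →
      ∀ t₀ ∈ Set.Ici (0:ℝ),
        Tendsto (fun t => ∫ ξ in Set.Ici (0:ℝ), lam ξ * ‖T t x ξ - T t₀ x ξ‖ ^ 2)
          (𝓝[Set.Ici 0] t₀) (𝓝 0)) ∧
    -- (d) characterization of the generator
    (∀ x : ℝ → ℂ,
      AEStronglyMeasurable x (volume.restrict (Set.Ici 0)) →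
      IntegrableOn (fun ξ => lam ξ * ‖x ξ‖ ^ 2) (Set.Ici 0) →
      ∀ g : ℝ → ℂ,
        AEStronglyMeasurable g (volume.restrict (Set.Ici 0)) →
        IntegrableOn (fun ξ => lam ξ * ‖g ξ‖ ^ 2) (Set.Ici 0) →
        (Tendsto (fun t : ℝ =>
              ∫ ξ in Set.Ici (0:ℝ), lam ξ * ‖(T t x ξ - x ξ) / (t : ℂ) - g ξ‖ ^ 2)
            (𝓝[>] (0:ℝ)) (𝓝 0)
          ↔ ∃ y : ℝ → ℂ,
              (∀ᵐ ξ ∂volume.restrict (Set.Ici 0), y ξ = (lam ξ : ℂ) * x ξ) ∧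
              ∀ a ∈ Set.Ici (0:ℝ), ∀ b ∈ Set.Ici (0:ℝ),
                y b - y a = ∫ ζ in a..b, g ζ)) := by
  have H : IsReparam lam p pinv :=
    isReparam_of_integral hc hpos hp hpinv_mem hpinv_right hpinv_left
  have hT' : ∀ t x ξ, T t x ξ = ((lam (pinv (p ξ + t)) / lam ξ : ℝ) : ℂ) * x (pinv (p ξ + t)) := by
    intro t x ξ
    rw [hT, hmu, add_sub_cancel]
  have hshift : ∀ t, 0 ≤ t → ∀ x, ∀ s ∈ Ici (0 : ℝ),
      reparamMap lam pinv (T t x) s = reparamMap lam pinv x (s + t) := by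
    intro t ht x s hs
    have h1 : (lam (pinv s) : ℂ) ≠ 0 := by
      exact_mod_cast (hpos _ (hpinv_mem s hs)).ne'
    simp only [reparamMap, hT', hpinv_right s hs, Complex.ofReal_div]
    field_simp
  refine ⟨fun x y c t ξ => ?_, fun t ht x hx hx2 => ?_, fun x ξ hξ => ?_,
    fun s t hs ht x ξ hξ => ?_, fun x hx hx2 t₀ ht₀ => ?_, fun x hx hx2 g hg hg2 => ?_⟩
  · simp only [hT, smul_eq_mul]
    ring
  · have hu := H.memLp_reparamMap hx hx2
    have hTu : MemLp (reparamMap lam pinv (T t x)) 2 (volume.restrict (Ici 0)) := by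
      refine (memLp_congr_ae ?_).1 (memLp_shift hu ht)
      filter_upwards [ae_restrict_mem measurableSet_Ici] with s hs using (hshift t ht x s hs).symm
    refine ⟨H.aestronglyMeasurable_of_reparamMap hTu.1, (H.integrableOn_norm_sq_reparamMap _).1
      ((memLp_two_iff_integrable_sq_norm hTu.1).1 hTu), ?_⟩
    rw [H.integral_norm_sq_reparamMap, H.integral_norm_sq_reparamMap]
    refine le_trans (le_of_eq ?_) (integral_norm_sq_shift_le hu ht)
    exact setIntegral_congr_fun measurableSet_Ici fun s hs => by simp only [hshift t ht x s hs]
  · rw [hT', add_zero, hpinv_left ξ hξ, div_self (hpos ξ hξ).ne', Complex.ofReal_one, one_mul]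
  · have h0 : 0 ≤ p ξ + t := add_nonneg (H.nonneg ξ hξ) ht
    have h1 : (lam (pinv (p ξ + t)) : ℂ) ≠ 0 := by
      exact_mod_cast (hpos _ (hpinv_mem _ h0)).ne'
    simp only [hT', hpinv_right _ h0, Complex.ofReal_div, add_assoc]
    field_simp
  · have hu := H.memLp_reparamMap hx hx2
    have hlim := (tendsto_integral_norm_sq_iff (l := 𝓝[Ici 0] t₀) (by
      filter_upwards [self_mem_nhdsWithin] with t ht using
        (memLp_shift hu ht).sub (memLp_shift hu ht₀))).2 (tendsto_lintegral_shift_sub hu ht₀)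
    refine hlim.congr' ?_
    filter_upwards [self_mem_nhdsWithin] with t ht
    rw [H.integral_norm_sq_reparamMap]
    refine setIntegral_congr_fun measurableSet_Ici fun s hs => ?_
    simp only [← hshift t ht x s hs, ← hshift t₀ ht₀ x s hs]
    simp only [reparamMap, mul_sub]
  · have hu := H.memLp_reparamMap hx hx2
    have hv := H.memLp_reparamMap hg hg2
    rw [← H.exists_integral_reparamMap_iff]
    have hcongr : (fun t : ℝ => ∫ ξ in Ici (0 : ℝ), lam ξ * ‖(T t x ξ - x ξ) / (t : ℂ) - g ξ‖ ^ 2)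
        =ᶠ[𝓝[>] 0] fun t : ℝ => ∫ s in Ici (0 : ℝ), ‖(reparamMap lam pinv x (s + t) -
          reparamMap lam pinv x s) / (t : ℂ) - reparamMap lam pinv g s‖ ^ 2 := by
      filter_upwards [self_mem_nhdsWithin] with t ht
      rw [H.integral_norm_sq_reparamMap]
      refine setIntegral_congr_fun measurableSet_Ici fun s hs => ?_
      simp only [← hshift t (le_of_lt ht) x s hs]
      simp only [reparamMap]
      ring_nf
    rw [tendsto_congr' hcongr, tendsto_integral_norm_sq_iff (by
      filter_upwards [self_mem_nhdsWithin] with t ht using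
        memLp_diffQuot_sub hu hv (le_of_lt ht))]
    exact ⟨exists_integral_of_tendsto_diffQuot hu hv, fun ⟨w, hwu, hw⟩ =>
      tendsto_diffQuot_of_integral hv hwu hw⟩
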